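/- arXiv:math/0510484 — 2 statements merged into one kernel-verified Lean document; each statement's English description precedes it below -/
import Mathlib

section
/- If 𝔟 < 𝔡, then there exists a subspace of the Baire space ℕ^ℕ which has the property Ufin(𝒪,T*) but fails the Hurewicz property Ufin(𝒪,Γ). -/
open Set Cardinal

/-- `A ⊆* B` : almost inclusion, i.e. `A \ B` is finite. -/
def AlmostSub (A B : Set ℕ) : Prop := (A \ B).Finite

/-- The Marczewski map: `mu u x = {n | x ∈ u n}`. -/
def mu {X : Type*} (u : ℕ → Set X) (x : X) : Set ℕ := {n | x ∈ u n}

/-- `u` is a γ-cover: every `mu u x` is cofinite. -/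
def IsGammaCover {X : Type*} (u : ℕ → Set X) : Prop :=
  ∀ x : X, (mu u x)ᶜ.Finite

/-- `u` is an ω-cover: the family `mu u '' X` is centered. -/
def IsOmegaCover {X : Type*} (u : ℕ → Set X) : Prop :=
  ∀ K : Finset X, (⋂ x ∈ K, mu u x).Infinite

/-- `u` is a τ-cover. -/
def IsTauCover {X : Type*} (u : ℕ → Set X) : Prop :=
  (∀ x : X, (mu u x).Infinite) ∧
  ∀ x₁ x₂ : X, AlmostSub (mu u x₁) (mu u x₂) ∨ AlmostSub (mu u x₂) (mu u x₁)

/-- A family of sets of naturals is linearly preordered by `⊆*`. -/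
def LinearAlmost (J : Set (Set ℕ)) : Prop :=
  ∀ A ∈ J, ∀ B ∈ J, AlmostSub A B ∨ AlmostSub B A

/-- `u` is a τ*-cover: some family `J` of infinite subsets of `ℕ`, linearly
preordered by `⊆*`, refines `mu u '' X`. -/
def IsTauAstCover {X : Type*} (u : ℕ → Set X) : Prop :=
  ∃ J : Set (Set ℕ), (∀ A ∈ J, A.Infinite) ∧ LinearAlmost J ∧
    ∀ x : X, ∃ A ∈ J, A ⊆ mu u x

/-- `u` is a τ⋆-cover: some family `J ⊆ mu u '' X` of infinite subsets of `ℕ`,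
linearly preordered by `⊆*`, refines `mu u '' X`. -/
def IsTauStarCover {X : Type*} (u : ℕ → Set X) : Prop :=
  ∃ J : Set (Set ℕ), J ⊆ Set.range (mu u) ∧ (∀ A ∈ J, A.Infinite) ∧ LinearAlmost J ∧
    ∀ x : X, ∃ A ∈ J, A ⊆ mu u x

/-- An open cover of the whole space. -/
def IsOpenCover {X : Type*} [TopologicalSpace X] (u : Set (Set X)) : Prop :=
  (∀ U ∈ u, IsOpen U) ∧ ⋃₀ u = Set.univ

/-- The selection principle `Ufin(O, P)` : for every sequence of open covers `u n`
there are finite `v n ⊆ u n` such that the sequence `n ↦ ⋃₀ v n` satisfies `P`. -/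
def Ufin (X : Type*) [TopologicalSpace X] (P : (ℕ → Set X) → Prop) : Prop :=
  ∀ u : ℕ → Set (Set X), (∀ n, IsOpenCover (u n)) →
    ∃ v : ℕ → Set (Set X), (∀ n, (v n).Finite ∧ v n ⊆ u n) ∧ P (fun n => ⋃₀ v n)

/-- The Menger property `Ufin(O,O)`. -/
def UfinO (X : Type*) [TopologicalSpace X] : Prop :=
  Ufin X (fun w => ∀ x : X, ∃ n, x ∈ w n)

/-- The Hurewicz property `Ufin(O,Γ)`. -/
def UfinGamma (X : Type*) [TopologicalSpace X] : Prop := Ufin X IsGammaCover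

/-- `Ufin(O,Ω)`. -/
def UfinOmega (X : Type*) [TopologicalSpace X] : Prop := Ufin X IsOmegaCover

/-- `Ufin(O,T)`. -/
def UfinTau (X : Type*) [TopologicalSpace X] : Prop := Ufin X IsTauCover

/-- `Ufin(O,T*)`. -/
def UfinTauAst (X : Type*) [TopologicalSpace X] : Prop := Ufin X IsTauAstCover

/-- `Ufin(O,T⋆)`. -/
def UfinTauStar (X : Type*) [TopologicalSpace X] : Prop := Ufin X IsTauStarCover

/-- The upward `⊆*`-closure of a family of subsets of `ℕ`. -/
def upCl (A : Set (Set ℕ)) : Set (Set ℕ) := {B | ∃ a ∈ A, AlmostSub a B}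

/-- A semifilter on `ℕ`. -/
def IsSemifilter (F : Set (Set ℕ)) : Prop :=
  (∀ A ∈ F, A.Nonempty) ∧ ∀ A ∈ F, ∀ B : Set ℕ, AlmostSub A B → B ∈ F

/-- A filter on `ℕ` (in the semifilter sense): a semifilter closed under finite
intersections. -/
def IsFilterFam (F : Set (Set ℕ)) : Prop :=
  IsSemifilter F ∧ ∀ A ∈ F, ∀ B ∈ F, A ∩ B ∈ F

/-- A simple P-filter: a filter consisting of infinite sets with a base linearly
preordered by `⊆*`. -/
def IsSimplePFilter (F : Set (Set ℕ)) : Prop :=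
  IsFilterFam F ∧ (∀ A ∈ F, A.Infinite) ∧
  ∃ B : Set (Set ℕ), B ⊆ F ∧ F = upCl B ∧ LinearAlmost B

/-- A family of subsets of `ℕ` is meager if the corresponding set of
characteristic functions is meager in the Cantor space `ℕ → Bool`. -/
def MeagerFam (F : Set (Set ℕ)) : Prop :=
  IsMeagre {f : ℕ → Bool | {n | f n = true} ∈ F}

/-- A family of subsets of `ℕ` is comeager if the corresponding set of
characteristic functions is comeager in the Cantor space `ℕ → Bool`. -/
def ComeagerFam (F : Set (Set ℕ)) : Prop :=
  {f : ℕ → Bool | {n | f n = true} ∈ F} ∈ residual (ℕ → Bool)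

/-- `x ≤* y` : eventual dominance. -/
def evLE (x y : ℕ → ℕ) : Prop := {n | y n < x n}.Finite

/-- The unbounding number `𝔟`. -/
noncomputable def cardB : Cardinal :=
  sInf {c | ∃ S : Set (ℕ → ℕ), c = #S ∧ ¬ ∃ y : ℕ → ℕ, ∀ x ∈ S, evLE x y}

/-- The dominating number `𝔡`. -/
noncomputable def cardD : Cardinal :=
  sInf {c | ∃ S : Set (ℕ → ℕ), c = #S ∧ ∀ x : ℕ → ℕ, ∃ y ∈ S, evLE x y}

/-- The ultrafilter number `𝔲`. -/
noncomputable def cardU : Cardinal :=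
  sInf {c | ∃ (U : Ultrafilter ℕ) (B : Set (Set ℕ)), c = #B ∧
    (∀ A ∈ U, A.Infinite) ∧ (∀ b ∈ B, b ∈ U) ∧ ∀ A ∈ U, ∃ b ∈ B, b ⊆ A}

/-- A groupwise dense family of infinite subsets of `ℕ`. -/
def IsGroupwiseDense (G : Set (Set ℕ)) : Prop :=
  (∀ A ∈ G, A.Infinite) ∧
  (∀ A ∈ G, ∀ B : Set ℕ, B.Infinite → B ⊆ A → B ∈ G) ∧
  ∀ k : ℕ → ℕ, StrictMono k →
    ∃ S : Set ℕ, S.Infinite ∧ (⋃ n ∈ S, Set.Ico (k n) (k (n + 1))) ∈ G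

/-- The groupwise density number `𝔤`. -/
noncomputable def cardG : Cardinal :=
  sInf {c | ∃ 𝒢 : Set (Set (Set ℕ)), c = #𝒢 ∧ (∀ G ∈ 𝒢, IsGroupwiseDense G) ∧ ⋂₀ 𝒢 = ∅}

/-- A tower of length `lam`: a `⊆*`-decreasing transfinite sequence of infinite
subsets of `ℕ` indexed by the ordinals below `lam`. -/
def IsTower (lam : Ordinal) (T : Ordinal → Set ℕ) : Prop :=
  (∀ α < lam, (T α).Infinite) ∧
  ∀ β α : Ordinal, β ≤ α → α < lam → AlmostSub (T α) (T β)

/-- `Depth⁺([ω]^{ℵ₀})`: the least cardinal `κ` such that there is no tower of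
length `κ`. -/
noncomputable def depthPlus : Cardinal :=
  sInf {c : Cardinal | ¬ ∃ T : Ordinal → Set ℕ, IsTower c.ord T}

/-- The tower number `𝔱`: the least length of a tower with no infinite
pseudo-intersection. -/
noncomputable def cardT : Cardinal :=
  sInf {c : Cardinal | ∃ T : Ordinal → Set ℕ, IsTower c.ord T ∧
    ¬ ∃ A : Set ℕ, A.Infinite ∧ ∀ α < c.ord, AlmostSub A (T α)}

/-- The trace of a family on the intervals determined by `k`. -/
def intervalTrace (k : ℕ → ℕ) (F : Set (Set ℕ)) : Set (Set ℕ) :=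
  {S | ∃ A ∈ F, S = {n | (A ∩ Set.Ico (k n) (k (n + 1))).Nonempty}}

/-- The Filter Dichotomy principle. -/
def FilterDichotomy : Prop :=
  ∀ F U : Set (Set ℕ), IsFilterFam F → IsFilterFam U →
    ¬ MeagerFam F → ¬ ComeagerFam F → ¬ MeagerFam U → ¬ ComeagerFam U →
    ∃ k : ℕ → ℕ, StrictMono k ∧ intervalTrace k F = intervalTrace k U

/-- `B` is `u`-bounded: `B` is contained in the union of a finite subfamily of `u`. -/
def BoundedBy {X : Type*} (u : Set (Set X)) (B : Set X) : Prop :=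
  ∃ v : Set (Set X), v ⊆ u ∧ v.Finite ∧ B ⊆ ⋃₀ v

/-- The weak excluded middle property of a subset of the Baire space. -/
def WeakExcludedMiddle (Z : Set (ℕ → ℕ)) : Prop :=
  ∃ x : ℕ → ℕ, ∃ F : Set (Set ℕ), IsSimplePFilter F ∧ ∀ z ∈ Z, {n | z n ≤ x n} ∈ F

theorem evLE_of_le {x y : ℕ → ℕ} (hxy : x ≤ y) : evLE x y := by
  have : {n | y n < x n} = ∅ := by
    ext n
    simpa using hxy n
  simp [evLE, this]

theorem evLE.trans {x y z : ℕ → ℕ} (hxy : evLE x y) (hyz : evLE y z) : evLE x z := by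
  refine (Set.Finite.union hxy hyz).subset fun n hn => ?_
  simp only [mem_ofPred_eq, mem_union] at *
  omega

/-- The number `𝔟` is attained by an unbounded family. -/
theorem exists_unbounded_card_eq_cardB :
    ∃ S : Set (ℕ → ℕ), cardB = #S ∧ ¬ ∃ y : ℕ → ℕ, ∀ x ∈ S, evLE x y := by
  refine csInf_mem (s := {c | ∃ S : Set (ℕ → ℕ), c = #S ∧ ¬ ∃ y : ℕ → ℕ, ∀ x ∈ S, evLE x y})
    ⟨_, Set.univ, rfl, ?_⟩
  rintro ⟨y, hy⟩
  have := hy (fun n => y n + 1) (mem_univ _)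
  simp [evLE, Set.infinite_univ.not_finite] at this

theorem exists_bound_of_card_lt_cardB {S : Set (ℕ → ℕ)} (hS : #S < cardB) :
    ∃ y : ℕ → ℕ, ∀ x ∈ S, evLE x y := by
  by_contra hc
  exact notMem_of_lt_csInf' hS ⟨S, rfl, hc⟩

theorem exists_not_evLE_of_card_lt_cardD {S : Set (ℕ → ℕ)} (hS : #S < cardD) :
    ∃ x : ℕ → ℕ, ∀ y ∈ S, ¬ evLE x y := by
  by_contra! hc
  exact notMem_of_lt_csInf' hS ⟨S, rfl, hc⟩

/-- A family of at most `𝔟` functions is pointwise dominated by a family that is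
linearly preordered by `≤*`. -/
theorem exists_evLE_chain {ι : Type} (hι : #ι ≤ cardB) (f : ι → ℕ → ℕ) :
    ∃ g : ι → ℕ → ℕ, (∀ i, f i ≤ g i) ∧ ∀ i j, evLE (g i) (g j) ∨ evLE (g j) (g i) := by
  obtain ⟨r, hr, hord⟩ := Cardinal.exists_ord_eq ι
  have hb : ∀ S : Set (ℕ → ℕ), ∃ y : ℕ → ℕ, #S < cardB → ∀ x ∈ S, evLE x y := fun S => by
    by_cases hS : #S < cardB
    · obtain ⟨y, hy⟩ := exists_bound_of_card_lt_cardB hS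
      exact ⟨y, fun _ => hy⟩
    · exact ⟨0, fun h => absurd h hS⟩
  choose bound hbound using hb
  let g : ι → ℕ → ℕ := hr.wf.fix fun i ih =>
    f i ⊔ bound (Set.range fun j : {j // r j i} => ih j.1 j.2)
  have hg : ∀ i, g i = f i ⊔ bound (Set.range fun j : {j // r j i} => g j.1) :=
    fun i => hr.wf.fix_eq _ i
  have hmono : ∀ i j, r j i → evLE (g j) (g i) := fun i j hji => by
    have hcard : #(Set.range fun j : {j // r j i} => g j.1) < cardB :=
      (Cardinal.mk_range_le.trans_lt (Cardinal.card_typein_lt i hord)).trans_le hι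
    refine evLE.trans (hbound _ hcard _ ⟨⟨j, hji⟩, rfl⟩) (evLE_of_le ?_)
    rw [hg i]
    exact le_sup_right
  refine ⟨g, fun i => ?_, fun i j => ?_⟩
  · rw [hg i]
    exact le_sup_left
  · rcases trichotomous_of r i j with hij | rfl | hji
    · exact Or.inl (hmono j i hij)
    · exact Or.inl (evLE_of_le le_rfl)
    · exact Or.inr (hmono i j hji)

/-- Second countable spaces of cardinality at most `𝔟 < 𝔡` satisfy `Ufin(O,T*)`. -/
theorem ufinTauAst_of_card_le_cardB {X : Type} [TopologicalSpace X]
    [SecondCountableTopology X] [Nonempty X] (h : cardB < cardD) (hX : #X ≤ cardB) :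
    UfinTauAst X := by
  intro u hu
  have henum : ∀ n, ∃ U : ℕ → Set X, (∀ k, U k ∈ u n) ∧ ∀ x, ∃ k, x ∈ U k := fun n => by
    obtain ⟨T, hTc, hTu, hT⟩ := TopologicalSpace.isOpen_sUnion_countable (u n) (hu n).1
    rw [(hu n).2] at hT
    have hne : T.Nonempty := by
      obtain ⟨t, ht, -⟩ := hT.symm ▸ mem_univ (Classical.arbitrary X)
      exact ⟨t, ht⟩
    obtain ⟨U, rfl⟩ := hTc.exists_eq_range hne
    refine ⟨U, fun k => hTu ⟨k, rfl⟩, fun x => ?_⟩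
    obtain ⟨_, ⟨k, rfl⟩, hk⟩ := hT.symm ▸ mem_univ x
    exact ⟨k, hk⟩
  choose U hUu hUcov using henum
  choose f hf using fun x n => hUcov n x
  obtain ⟨g, hfg, hg⟩ := exists_evLE_chain hX f
  obtain ⟨x, hx⟩ := exists_not_evLE_of_card_lt_cardD (S := Set.range g)
    ((Cardinal.mk_range_le.trans hX).trans_lt h)
  have hsub : ∀ y z, evLE (g z) (g y) →
      AlmostSub {n | g y n < x n} {n | g z n < x n} := fun y z hzy => by
    refine Set.Finite.subset hzy fun n hn => ?_
    simp only [mem_sdiff, mem_ofPred_eq] at *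
    omega
  refine ⟨fun n => U n '' Set.Iic (x n), fun n => ⟨(Set.finite_Iic _).image _, ?_⟩,
    Set.range fun y => {n | g y n < x n}, ?_, ?_, fun y => ⟨_, ⟨y, rfl⟩, fun n hn => ?_⟩⟩
  · rintro _ ⟨k, -, rfl⟩
    exact hUu n k
  · rintro _ ⟨y, rfl⟩
    exact hx _ ⟨y, rfl⟩
  · rintro _ ⟨y, rfl⟩ _ ⟨z, rfl⟩
    exact (hg z y).imp (hsub y z) (hsub z y)
  · exact ⟨U n (f y n), ⟨f y n, (hfg y n).trans (le_of_lt hn), rfl⟩, hf y n⟩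

/-- A Hurewicz subspace of the Baire space is `≤*`-bounded. -/
theorem UfinGamma.exists_bound {Y : Set (ℕ → ℕ)} (hY : UfinGamma Y) :
    ∃ b : ℕ → ℕ, ∀ y ∈ Y, evLE y b := by
  obtain ⟨v, hv, hγ⟩ := hY (fun n => Set.range fun k : ℕ => {y : Y | y.1 n = k}) fun n => by
    refine ⟨?_, ?_⟩
    · rintro _ ⟨k, rfl⟩
      exact (isOpen_discrete {k}).preimage
        ((continuous_apply n).comp continuous_subtype_val : Continuous fun y : Y => y.1 n)
    · exact Set.eq_univ_of_forall fun y => ⟨_, ⟨y.1 n, rfl⟩, rfl⟩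
  have hb : ∀ n, ∃ m : ℕ, ∀ y : Y, y ∈ ⋃₀ v n → y.1 n ≤ m := fun n => by
    have hfin : ((fun y : Y => y.1 n) '' ⋃₀ v n).Finite := by
      rw [Set.sUnion_eq_biUnion, Set.image_iUnion₂]
      refine (hv n).1.biUnion fun s hs => ?_
      obtain ⟨k, rfl⟩ := (hv n).2 hs
      refine (Set.finite_singleton k).subset ?_
      rintro _ ⟨y, hy, rfl⟩
      exact hy
    obtain ⟨m, hm⟩ := hfin.bddAbove
    exact ⟨m, fun y hy => hm ⟨y, hy, rfl⟩⟩
  choose b hb using hb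
  refine ⟨b, fun y hy => (hγ ⟨y, hy⟩).subset fun n hn hmem => ?_⟩
  exact (not_le_of_gt hn) (hb n ⟨y, hy⟩ hmem)

/-- If `𝔟 < 𝔡`, then some subspace of the Baire space has `Ufin(O,T*)` but
fails the Hurewicz property `Ufin(O,Γ)`. -/
theorem stmt_6 (h : cardB < cardD) :
    ∃ Y : Set (ℕ → ℕ), UfinTauAst Y ∧ ¬ UfinGamma Y := by
  obtain ⟨Y, hcard, hY⟩ := exists_unbounded_card_eq_cardB
  have : Nonempty Y := by
    by_contra hne
    exact hY ⟨0, fun x hx => absurd ⟨⟨x, hx⟩⟩ hne⟩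
  exact ⟨Y, ufinTauAst_of_card_le_cardB h hcard.ge, fun hγ => hY hγ.exists_bound⟩
end

section
/- If 𝔱 = 𝔡, then there exists a subspace of the Baire space ℕ^ℕ which has the property Ufin(𝒪,T*) but fails the property Ufin(𝒪,T). -/
open Set Cardinal

open Filter

lemma almostSub_iff_eventually {A B : Set ℕ} :
    AlmostSub A B ↔ ∀ᶠ n in atTop, n ∈ A → n ∈ B := by
  rw [← Nat.cofinite_eq_atTop, eventually_cofinite]
  simp [AlmostSub, Set.sdiff_eq, Set.inter_def]

lemma evLE_iff_eventually {x y : ℕ → ℕ} : evLE x y ↔ ∀ᶠ n in atTop, x n ≤ y n := by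
  rw [← Nat.cofinite_eq_atTop, eventually_cofinite]
  simp [evLE]

lemma almostSub_of_subset {A B : Set ℕ} (h : A ⊆ B) : AlmostSub A B := by
  simp [AlmostSub, Set.sdiff_eq_empty.2 h]

lemma AlmostSub.trans {A B C : Set ℕ} (h₁ : AlmostSub A B) (h₂ : AlmostSub B C) :
    AlmostSub A C := by
  rw [almostSub_iff_eventually] at *
  filter_upwards [h₁, h₂] with n h h' hn using h' (h hn)

lemma AlmostSub.infinite {A B : Set ℕ} (h : AlmostSub A B) (hA : A.Infinite) : B.Infinite :=
  fun hB => hA ((h.union hB).subset fun n hn => by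
    by_cases hn' : n ∈ B
    · exact Or.inr hn'
    · exact Or.inl ⟨hn, hn'⟩)

/-- Towers of length less than `𝔱.ord` have infinite pseudo-intersections. -/
lemma IsTower.exists_pseudoIntersection {α : Ordinal} {T : Ordinal → Set ℕ} (hT : IsTower α T)
    (hα : α < cardT.ord) : ∃ A : Set ℕ, A.Infinite ∧ ∀ β < α, AlmostSub A (T β) := by
  obtain ⟨f, hf⟩ := Ordinal.exists_isFundamentalSeq (o := α) rfl
  have hcof : α.cof < cardT := (Ordinal.cof_le_card α).trans_lt (lt_ord.1 hα)
  set T' : Ordinal → Set ℕ := fun β => if hβ : β < α.cof.ord then T (f ⟨β, hβ⟩) else univ with hT'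
  have hT'f (β : Ordinal) (hβ : β < α.cof.ord) : T' β = T (f ⟨β, hβ⟩) := dif_pos hβ
  have htower : IsTower α.cof.ord T' := by
    refine ⟨fun β hβ => ?_, fun β γ hβγ hγ => ?_⟩
    · rw [hT'f β hβ]
      exact hT.1 _ (f _).2
    · rw [hT'f γ hγ, hT'f β (hβγ.trans_lt hγ)]
      exact hT.2 _ _ (hf.strictMono.monotone hβγ) (f _).2
  have hnot := notMem_of_lt_csInf' hcof
  obtain ⟨A, hA, hAT⟩ := not_not.1 fun hT' => hnot ⟨T', htower, hT'⟩
  refine ⟨A, hA, fun β hβ => ?_⟩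
  obtain ⟨_, ⟨⟨γ, hγ⟩, rfl⟩, hβγ⟩ := hf.isCofinal_range ⟨β, hβ⟩
  exact (hT'f γ hγ ▸ hAT γ hγ).trans (hT.2 _ _ hβγ (f _).2)

/-- The set of values of `t` at multiples of four. -/
def quarter (t : ℕ → ℕ) : Set ℕ := range fun i => t (4 * i)

lemma quarter_subset_range (t : ℕ → ℕ) : quarter t ⊆ range t := by
  rintro _ ⟨i, rfl⟩
  exact ⟨_, rfl⟩

lemma quarter_infinite {t : ℕ → ℕ} (ht : StrictMono t) : (quarter t).Infinite :=
  infinite_range_of_injective fun i j hij => by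
    have := ht.injective hij
    omega

lemma Set.Infinite.exists_sparse_sequence {A : Set ℕ} (hA : A.Infinite) (d : ℕ → ℕ) :
    ∃ t : ℕ → ℕ, StrictMono t ∧ (∀ k, d (t k) < t (k + 1)) ∧ range t ⊆ A := by
  choose g hgA hg using hA.exists_gt
  let t : ℕ → ℕ := fun k => Nat.rec (g 0) (fun _ a => g (max a (d a))) k
  have hsucc (k : ℕ) : max (t k) (d (t k)) < t (k + 1) := hg _
  refine ⟨t, strictMono_nat_of_lt_succ fun k => (le_max_left _ _).trans_lt (hsucc k),
    fun k => (le_max_right _ _).trans_lt (hsucc k), ?_⟩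
  rintro _ ⟨_ | k, rfl⟩
  exacts [hgA _, hgA _]

/-- There is a tower of length `𝔱.ord` whose `α`-th member is sparse with respect to `d α`. -/
lemma exists_sparse_tower (d : Ordinal → ℕ → ℕ) :
    ∃ t : Ordinal → ℕ → ℕ, ∀ α < cardT.ord, StrictMono (t α) ∧
      (∀ k, d α (t α k) < t α (k + 1)) ∧ ∀ β < α, AlmostSub (range (t α)) (quarter (t β)) := by
  let step (α : Ordinal) (prev : ∀ β, β < α → ℕ → ℕ) (s : ℕ → ℕ) : Prop :=
    StrictMono s ∧ (∀ k, d α (s k) < s (k + 1)) ∧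
      ∀ β (hβ : β < α), AlmostSub (range s) (quarter (prev β hβ))
  let t : Ordinal → ℕ → ℕ := WellFounded.fix Ordinal.lt_wf
    fun α prev => Classical.epsilon (step α prev)
  have ht (α : Ordinal) : t α = Classical.epsilon (step α fun β _ => t β) :=
    WellFounded.fix_eq _ _ _
  refine ⟨t, fun α => ?_⟩
  induction α using WellFoundedLT.induction with
  | _ α ih =>
    intro hα
    have htower : IsTower α fun β => quarter (t β) := by
      refine ⟨fun β hβ => quarter_infinite (ih β hβ (hβ.trans hα)).1, fun β γ hβγ hγ => ?_⟩
      rcases hβγ.eq_or_lt with rfl | hlt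
      · exact almostSub_of_subset subset_rfl
      · exact (almostSub_of_subset (quarter_subset_range _)).trans
          ((ih γ hγ (hγ.trans hα)).2.2 β hlt)
    obtain ⟨A, hA, hAt⟩ := htower.exists_pseudoIntersection hα
    obtain ⟨s, hs, hsd, hsA⟩ := hA.exists_sparse_sequence (d α)
    have hex : ∃ s, step α (fun β _ => t β) s :=
      ⟨s, hs, hsd, fun β hβ => (almostSub_of_subset hsA).trans (hAt β hβ)⟩
    rw [ht α]
    exact Classical.epsilon_spec hex

lemma eventually_sparse_of_almostSub {s t d : ℕ → ℕ} (hs : StrictMono s) (ht : StrictMono t)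
    (hsd : ∀ k, d (s k) < s (k + 1)) (h : AlmostSub (range t) (range s)) :
    ∀ᶠ k in atTop, d (t k) < t (k + 1) := by
  have hev : ∀ᶠ k in atTop, t k ∈ range s :=
    (ht.tendsto_atTop.eventually (almostSub_iff_eventually.1 h)).mono fun k hk => hk ⟨k, rfl⟩
  filter_upwards [hev, (tendsto_add_atTop_nat 1).eventually hev] with k ⟨m, hm⟩ ⟨m', hm'⟩
  have hlt : m < m' := hs.lt_iff_lt.1 (by rw [hm, hm']; exact ht k.lt_succ_self)
  rw [← hm, ← hm']
  exact (hsd m).trans_le (hs.monotone hlt)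

/-- Fewer than `𝔱` functions are eventually bounded by a single function. -/
lemma exists_eventually_bound {α : Ordinal} (hα : α < cardT.ord) (f : Ordinal → ℕ → ℕ) :
    ∃ x : ℕ → ℕ, ∀ β < α, ∀ᶠ n in atTop, f β n ≤ x n := by
  obtain ⟨t, ht⟩ := exists_sparse_tower fun β => partialSups (f β)
  obtain ⟨hmono, -, hsub⟩ := ht α hα
  refine ⟨fun n => t α (n + 1), fun β hβ => ?_⟩
  obtain ⟨hmonoβ, hsparse, -⟩ := ht β (hβ.trans hα)
  filter_upwards [eventually_sparse_of_almostSub hmonoβ hmono hsparse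
    ((hsub β hβ).trans (almostSub_of_subset (quarter_subset_range _)))] with n hn
  exact (le_partialSups_of_le (f β) (hmono.le_apply)).trans hn.le

/-- The index `k` with `t k ≤ j < t (k + 1)`, for strictly increasing `t`. -/
def blockIndex (t : ℕ → ℕ) (j : ℕ) : ℕ := Nat.findGreatest (fun k => t k ≤ j) j

lemma blockIndex_eq {t : ℕ → ℕ} (ht : StrictMono t) {k j : ℕ} (h₁ : t k ≤ j)
    (h₂ : j < t (k + 1)) : blockIndex t j = k := by
  rw [blockIndex, Nat.findGreatest_eq_iff]
  refine ⟨ht.le_apply.trans h₁, fun _ => h₁, fun m hm _ => not_le.2 ?_⟩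
  exact h₂.trans_le (ht.monotone hm)

/-- The function with the constant value `t (k + 1)` on `[t k, t (k + 1))` when `k ≡ r` modulo
four, and zero elsewhere. -/
def spike (t : ℕ → ℕ) (r j : ℕ) : ℕ :=
  if blockIndex t j % 4 = r then t (blockIndex t j + 1) else 0

lemma spike_le_of_lt {t : ℕ → ℕ} (ht : StrictMono t) {r i j : ℕ} (hr : r ≠ 0)
    (hj : j < t (4 * i)) : spike t r j ≤ t (4 * i) := by
  unfold spike
  split_ifs with h
  · have hne : blockIndex t j ≠ 0 := by
      rintro h0
      rw [h0] at h
      omega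
    have hle : t (blockIndex t j) ≤ j :=
      Nat.findGreatest_of_ne_zero (P := fun k => t k ≤ j) rfl hne
    exact ht.monotone (ht.lt_iff_lt.1 (hle.trans_lt hj))
  · exact Nat.zero_le _

lemma spike_eq_zero {t : ℕ → ℕ} (ht : StrictMono t) {r k j : ℕ} (hr : k % 4 ≠ r)
    (h₁ : t k ≤ j) (h₂ : j < t (k + 1)) : spike t r j = 0 := by
  simp [spike, blockIndex_eq ht h₁ h₂, hr]

lemma spike_eq {t : ℕ → ℕ} (ht : StrictMono t) {r k j : ℕ} (hr : k % 4 = r)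
    (h₁ : t k ≤ j) (h₂ : j < t (k + 1)) : spike t r j = t (k + 1) := by
  simp [spike, blockIndex_eq ht h₁ h₂, hr]

lemma IsOpen.exists_agree_subset {Y : Set (ℕ → ℕ)} {U : Set Y} (hU : IsOpen U) {q : Y}
    (hq : q ∈ U) : ∃ m : ℕ, ∀ y : Y, (∀ j < m, y.1 j = q.1 j) → y ∈ U := by
  obtain ⟨V, hV, rfl⟩ := isOpen_induced_iff.1 hU
  obtain ⟨I, w, hw, hsub⟩ := isOpen_pi_iff.1 hV q.1 hq
  refine ⟨I.sup id + 1, fun y hy => hsub fun j hj => ?_⟩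
  rw [hy j (Nat.lt_succ_of_le (Finset.le_sup (f := id) hj))]
  exact (hw j hj).2

/-- Open covers of a set containing all eventually zero sequences admit finite selections covering
every sequence that is small below `n` and vanishes on a long interval starting at `n`. -/
lemma exists_selection_near_eventually_zero {Y : Set (ℕ → ℕ)}
    (hY : ∀ q : ℕ → ℕ, (∀ᶠ j in atTop, q j = 0) → q ∈ Y) {u : ℕ → Set (Set Y)}
    (hu : ∀ n, IsOpenCover (u n)) :
    ∃ (v : ℕ → Set (Set Y)) (h : ℕ → ℕ), (∀ n, (v n).Finite ∧ v n ⊆ u n) ∧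
      ∀ n, ∀ y : Y, (∀ j < n, y.1 j ≤ n) → (∀ j, n ≤ j → j < h n → y.1 j = 0) → y ∈ ⋃₀ v n := by
  let q (n : ℕ) (f : Fin n → Fin (n + 1)) : Y :=
    ⟨fun j => if hj : j < n then f ⟨j, hj⟩ else 0, hY _ <| by
      filter_upwards [eventually_ge_atTop n] with j hj
      simp [hj]⟩
  have hcov (n : ℕ) (f : Fin n → Fin (n + 1)) : ∃ U ∈ u n, q n f ∈ U := by
    simpa [← mem_sUnion] using (hu n).2 ▸ mem_univ (q n f)
  choose U hUu hqU using hcov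
  choose m hm using fun n f => ((hu n).1 _ (hUu n f)).exists_agree_subset (hqU n f)
  refine ⟨fun n => range (U n), fun n => Finset.univ.sup (m n), fun n => ⟨finite_range _, ?_⟩,
    fun n y hle hzero => ?_⟩
  · rintro _ ⟨f, rfl⟩
    exact hUu n f
  · let f : Fin n → Fin (n + 1) := fun j => ⟨y.1 j, Nat.lt_succ_of_le (hle j j.2)⟩
    refine ⟨_, ⟨f, rfl⟩, hm n f y fun j hj => ?_⟩
    by_cases hjn : j < n
    · simp [q, f, hjn]
    · simpa [q, hjn] using hzero j (not_lt.1 hjn)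
        (hj.trans_le (Finset.le_sup (f := m n) (Finset.mem_univ f)))

lemma IsOpenCover.exists_countable_subcover {Y : Type*} [TopologicalSpace Y]
    [SecondCountableTopology Y] [Nonempty Y] {u : Set (Set Y)} (hu : IsOpenCover u) :
    ∃ U : ℕ → Set Y, (∀ k, U k ∈ u) ∧ ∀ y, ∃ k, y ∈ U k := by
  obtain ⟨T, hTc, hTu, hT⟩ := TopologicalSpace.isOpen_sUnion_countable u hu.1
  rw [hu.2] at hT
  have hne : T.Nonempty := by
    obtain ⟨V, hV, -⟩ : Classical.arbitrary Y ∈ ⋃₀ T := hT ▸ mem_univ _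
    exact ⟨V, hV⟩
  obtain ⟨U, rfl⟩ := hTc.exists_eq_range hne
  refine ⟨U, fun k => hTu ⟨k, rfl⟩, fun y => ?_⟩
  obtain ⟨_, ⟨k, rfl⟩, hk⟩ : y ∈ ⋃₀ range U := hT ▸ mem_univ y
  exact ⟨k, hk⟩

/-- The eventually zero sequences together with two spike functions for each `t α`, `α < κ`. -/
def spikeSpace (κ : Ordinal) (t : Ordinal → ℕ → ℕ) : Set (ℕ → ℕ) :=
  {y | (∀ᶠ j in atTop, y j = 0) ∨ ∃ α < κ, y = spike (t α) 1 ∨ y = spike (t α) 2}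

lemma exists_dominating_enumeration :
    ∃ d : Ordinal → ℕ → ℕ, ∀ x : ℕ → ℕ, ∃ β < cardD.ord, ∀ᶠ n in atTop, x n ≤ d β n := by
  have hne : {c : Cardinal | ∃ S : Set (ℕ → ℕ), c = #S ∧ ∀ x, ∃ y ∈ S, evLE x y}.Nonempty :=
    ⟨_, univ, rfl, fun x => ⟨x, mem_univ x, by simp [evLE]⟩⟩
  obtain ⟨S, hS, hdom⟩ := csInf_mem hne
  change cardD = #S at hS
  have hcard : #S = #cardD.ord.ToType := by rw [mk_toType, card_ord, hS]
  obtain ⟨e⟩ := Cardinal.eq.1 hcard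
  refine ⟨fun β => if hβ : β < cardD.ord then (e.symm (Ordinal.ToType.mk ⟨β, hβ⟩)).1 else 0,
    fun x => ?_⟩
  obtain ⟨y, hy, hxy⟩ := hdom x
  obtain ⟨β, hβ⟩ := Ordinal.ToType.mk.surjective (e ⟨y, hy⟩)
  refine ⟨β.1, β.2, ?_⟩
  have hβ' : β.1 < cardD.ord := β.2
  simp only [hβ', dif_pos]
  simpa [hβ] using evLE_iff_eventually.1 hxy

section

variable {d t : Ordinal → ℕ → ℕ}

lemma ufinTauAst_spikeSpace
    (hd : ∀ x : ℕ → ℕ, ∃ β < cardT.ord, ∀ᶠ n in atTop, x n ≤ d β n)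
    (ht : ∀ α < cardT.ord, StrictMono (t α) ∧
      (∀ k, d α (t α k) < t α (k + 1)) ∧ ∀ β < α, AlmostSub (range (t α)) (quarter (t β))) :
    UfinTauAst (spikeSpace cardT.ord t) := by
  classical
  intro u hu
  have hzero (q : ℕ → ℕ) (hq : ∀ᶠ j in atTop, q j = 0) : q ∈ spikeSpace cardT.ord t := Or.inl hq
  have : Nonempty (spikeSpace cardT.ord t) := ⟨⟨0, hzero 0 (by simp)⟩⟩
  obtain ⟨v₀, h, hv₀, hcov₀⟩ := exists_selection_near_eventually_zero hzero hu
  choose U hUu hU using fun n => (hu n).exists_countable_subcover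
  choose idx hidx using hU
  obtain ⟨β₀, hβ₀, hhd⟩ := hd h
  obtain ⟨x₁, hx₁⟩ := exists_eventually_bound hβ₀ fun α n =>
    if hα : spike (t α) 1 ∈ spikeSpace cardT.ord t then idx n ⟨_, hα⟩ else 0
  obtain ⟨x₂, hx₂⟩ := exists_eventually_bound hβ₀ fun α n =>
    if hα : spike (t α) 2 ∈ spikeSpace cardT.ord t then idx n ⟨_, hα⟩ else 0
  let v (n : ℕ) : Set (Set (spikeSpace cardT.ord t)) := v₀ n ∪ U n '' Iic (max (x₁ n) (x₂ n))
  have hmem_idx (n : ℕ) (y : spikeSpace cardT.ord t) (hy : idx n y ≤ max (x₁ n) (x₂ n)) :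
      y ∈ ⋃₀ v n := ⟨_, Or.inr ⟨_, hy, rfl⟩, hidx n y⟩
  have hmem_zero (n : ℕ) (y : spikeSpace cardT.ord t) (hle : ∀ j < n, y.1 j ≤ n)
      (hy : ∀ j, n ≤ j → j < h n → y.1 j = 0) : y ∈ ⋃₀ v n :=
    sUnion_subset_sUnion subset_union_left (hcov₀ n y hle hy)
  refine ⟨v, fun n => ⟨(hv₀ n).1.union ((finite_Iic _).image _), union_subset (hv₀ n).2 ?_⟩, ?_⟩
  · rintro _ ⟨k, -, rfl⟩
    exact hUu n k
  refine ⟨{A | ∃ α < cardT.ord, AlmostSub A (quarter (t α)) ∧ AlmostSub (quarter (t α)) A},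
    ?_, ?_, ?_⟩
  · rintro A ⟨α, hα, -, hA⟩
    exact hA.infinite (quarter_infinite (ht α hα).1)
  · have key (α β : Ordinal) (hβα : β ≤ α) (hα : α < cardT.ord) :
        AlmostSub (quarter (t α)) (quarter (t β)) := by
      rcases hβα.eq_or_lt with rfl | hlt
      · exact almostSub_of_subset subset_rfl
      · exact (almostSub_of_subset (quarter_subset_range _)).trans ((ht α hα).2.2 β hlt)
    rintro A ⟨α, hα, hA, hA'⟩ B ⟨β, hβ, hB, hB'⟩
    rcases le_total β α with hle | hle
    · exact Or.inl (hA.trans ((key α β hle hα).trans hB'))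
    · exact Or.inr (hB.trans ((key β α hle hβ).trans hA'))
  intro y
  suffices hmu : ∃ α < cardT.ord, AlmostSub (quarter (t α)) (mu (fun n => ⋃₀ v n) y) by
    obtain ⟨α, hα, hsub⟩ := hmu
    refine ⟨quarter (t α) ∩ mu (fun n => ⋃₀ v n) y,
      ⟨α, hα, almostSub_of_subset inter_subset_left, ?_⟩, inter_subset_right⟩
    simpa [AlmostSub] using hsub
  have hcofinite (hy : ∀ᶠ n in atTop, y ∈ ⋃₀ v n) :
      ∃ α < cardT.ord, AlmostSub (quarter (t α)) (mu (fun n => ⋃₀ v n) y) :=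
    ⟨β₀, hβ₀, almostSub_iff_eventually.2 (hy.mono fun n hn _ => hn)⟩
  have hlarge (α : Ordinal) (hα : α < cardT.ord) (hβα : β₀ ≤ α) (r : ℕ) (hr : r ≠ 0)
      (hy : y.1 = spike (t α) r) : AlmostSub (quarter (t α)) (mu (fun n => ⋃₀ v n) y) := by
    have hmono := (ht α hα).1
    have hsub : AlmostSub (range (t α)) (range (t β₀)) := by
      rcases hβα.eq_or_lt with rfl | hlt
      · exact almostSub_of_subset subset_rfl
      · exact ((ht α hα).2.2 β₀ hlt).trans (almostSub_of_subset (quarter_subset_range _))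
    obtain ⟨K, hK⟩ := eventually_atTop.1 ((eventually_sparse_of_almostSub (ht β₀ hβ₀).1 hmono
      (ht β₀ hβ₀).2.1 hsub).and (hmono.tendsto_atTop.eventually hhd))
    rw [almostSub_iff_eventually]
    filter_upwards [eventually_ge_atTop (t α K)]
    rintro _ hn ⟨i, rfl⟩
    obtain ⟨h₁, h₂⟩ := hK (4 * i) (hmono.le_iff_le.1 hn)
    refine hmem_zero _ y (fun j hj => ?_) fun j hj₁ hj₂ => ?_
    · rw [hy]
      exact spike_le_of_lt hmono hr hj
    · rw [hy]
      exact spike_eq_zero hmono (by omega) hj₁ (hj₂.trans_le h₂ |>.trans h₁)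
  obtain ⟨y, hy₀ | ⟨α, hα, hy⟩⟩ := y
  · obtain ⟨m, hm⟩ := eventually_atTop.1 hy₀
    refine hcofinite ?_
    filter_upwards [eventually_ge_atTop m, eventually_ge_atTop ((Finset.range m).sup y)]
      with n hn hn'
    refine hmem_zero n _ (fun j _ => ?_) fun j hj _ => hm j (hn.trans hj)
    by_cases hjm : j < m
    · exact (Finset.le_sup (f := y) (Finset.mem_range.2 hjm)).trans hn'
    · simp [hm j (not_lt.1 hjm)]
  · rcases le_or_gt β₀ α with hβα | hlt
    · rcases hy with hy | hy
      · exact ⟨α, hα, hlarge α hα hβα 1 (by simp) hy⟩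
      · exact ⟨α, hα, hlarge α hα hβα 2 (by simp) hy⟩
    · refine hcofinite ?_
      rcases hy with rfl | rfl
      · filter_upwards [hx₁ α hlt] with n hn
        have hmem : spike (t α) 1 ∈ spikeSpace cardT.ord t := Or.inr ⟨α, hα, Or.inl rfl⟩
        rw [dif_pos hmem] at hn
        exact hmem_idx n _ (hn.trans (le_max_left _ _))
      · filter_upwards [hx₂ α hlt] with n hn
        have hmem : spike (t α) 2 ∈ spikeSpace cardT.ord t := Or.inr ⟨α, hα, Or.inr rfl⟩
        rw [dif_pos hmem] at hn
        exact hmem_idx n _ (hn.trans (le_max_right _ _))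

lemma not_ufinTau_spikeSpace {κ : Ordinal}
    (hd : ∀ x : ℕ → ℕ, ∃ β < κ, ∀ᶠ n in atTop, x n ≤ d β n)
    (ht : ∀ α < κ, StrictMono (t α) ∧ ∀ k, d α (t α k) < t α (k + 1)) :
    ¬ UfinTau (spikeSpace κ t) := by
  intro hτ
  let V (n k : ℕ) : Set (spikeSpace κ t) := {y | y.1 n ≤ k}
  have hVopen (n k : ℕ) : IsOpen (V n k) :=
    (isOpen_discrete (Iic k)).preimage
      (show Continuous fun y : spikeSpace κ t => y.1 n from
        (continuous_apply n).comp continuous_subtype_val)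
  obtain ⟨v, hv, hinf, hlin⟩ := hτ (fun n => range (V n)) fun n =>
    ⟨forall_mem_range.2 (hVopen n),
      eq_univ_of_forall fun y => ⟨_, ⟨y.1 n, rfl⟩, show y.1 n ≤ y.1 n from le_rfl⟩⟩
  have hbound (n : ℕ) : ∃ b, ∀ y ∈ ⋃₀ v n, y.1 n ≤ b := by
    have hU (U : Set (spikeSpace κ t)) (hU : U ∈ v n) : ∃ k, U = V n k := by
      obtain ⟨k, hk⟩ := (hv n).2 hU
      exact ⟨k, hk.symm⟩
    choose! k hk using hU
    obtain ⟨b, hb⟩ := ((hv n).1.image k).bddAbove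
    refine ⟨b, fun y ⟨U, hU, hyU⟩ => ?_⟩
    rw [hk U hU] at hyU
    exact le_trans hyU (hb ⟨U, hU, rfl⟩)
  choose b hb using hbound
  have hD : ∀ n, ∃ j ≥ n, (v j).Nonempty := by
    intro n
    obtain ⟨j, ⟨U, hU, -⟩, hj⟩ := (hinf ⟨0, Or.inl (by simp)⟩).exists_gt n
    exact ⟨j, hj.le, U, hU⟩
  choose next hnext hne using hD
  obtain ⟨β, hβ, hdom⟩ := hd fun n => max (next n) (b (next n))
  obtain ⟨hmono, hsparse⟩ := ht β hβ
  have hmem (y : spikeSpace κ t) (j : ℕ) (hj : (v j).Nonempty) (hy : y.1 j = 0) :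
      j ∈ mu (fun n => ⋃₀ v n) y := by
    obtain ⟨U, hU⟩ := hj
    obtain ⟨k, rfl⟩ := (hv j).2 hU
    exact ⟨_, hU, show y.1 j ≤ k by simp [hy]⟩
  have hnot (r r' : ℕ) (hr : r < 4) (hrr' : r ≠ r') (y y' : spikeSpace κ t)
      (hy : y.1 = spike (t β) r) (hy' : y'.1 = spike (t β) r') :
      ¬ AlmostSub (mu (fun n => ⋃₀ v n) y') (mu (fun n => ⋃₀ v n) y) := by
    intro hsub
    obtain ⟨N, hN⟩ := eventually_atTop.1 ((almostSub_iff_eventually.1 hsub).and hdom)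
    obtain ⟨k, hk⟩ : ∃ k, k = 4 * N + r := ⟨_, rfl⟩
    have hkN : N ≤ t β k := le_trans (by omega) hmono.le_apply
    have hmax : max (next (t β k)) (b (next (t β k))) < t β (k + 1) :=
      (hN _ hkN).2.trans_lt (hsparse k)
    set j := next (t β k) with hj
    have h₁ : t β k ≤ j := hnext _
    have h₂ : j < t β (k + 1) := (le_max_left _ _).trans_lt hmax
    have hj' : j ∈ mu (fun n => ⋃₀ v n) y' :=
      hmem y' j (hne _) (by rw [hy']; exact spike_eq_zero hmono (by omega) h₁ h₂)
    have hle := hb j y ((hN j (hkN.trans h₁)).1 hj')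
    rw [hy, spike_eq hmono (by omega) h₁ h₂] at hle
    exact absurd hmax (not_lt.2 (hle.trans (le_max_right _ _)))
  let y₁ : spikeSpace κ t := ⟨spike (t β) 1, Or.inr ⟨β, hβ, Or.inl rfl⟩⟩
  let y₂ : spikeSpace κ t := ⟨spike (t β) 2, Or.inr ⟨β, hβ, Or.inr rfl⟩⟩
  rcases hlin y₁ y₂ with hsub | hsub
  · exact hnot 2 1 (by simp) (by simp) y₂ y₁ rfl rfl hsub
  · exact hnot 1 2 (by simp) (by simp) y₁ y₂ rfl rfl hsub

end

/-- If `𝔱 = 𝔡`, then some subspace of the Baire space has `Ufin(O,T*)` but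
fails `Ufin(O,T)`. -/
theorem stmt_7 (h : cardT = cardD) :
    ∃ Y : Set (ℕ → ℕ), UfinTauAst Y ∧ ¬ UfinTau Y := by
  obtain ⟨d, hd⟩ := exists_dominating_enumeration
  rw [← h] at hd
  obtain ⟨t, ht⟩ := exists_sparse_tower d
  exact ⟨spikeSpace cardT.ord t, ufinTauAst_spikeSpace hd ht,
    not_ufinTau_spikeSpace hd fun α hα => ⟨(ht α hα).1, (ht α hα).2.1⟩⟩
end
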